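/- arXiv:1802.05966 — 4 statements merged into one kernel-verified Lean document; each statement's English description precedes it below -/
import Mathlib

section
/- For every invertible real d×d matrix M and every r ∈ ℕ, the r-th Fréchet derivative of the inversion map inv : M ↦ M⁻¹ satisfies the operator-norm bound ‖D^r inv(M)‖ ≤ r! ‖M⁻¹‖₂^{r+1}, where ‖D^r inv(M)‖ is the norm of D^r inv(M) as an r-linear map from (ℝ^{d×d})^r to ℝ^{d×d}. -/
section RingInverse

variable (𝕜 : Type*) [NontriviallyNormedField 𝕜] {R : Type*} [NormedRing R] [NormedAlgebra 𝕜 R]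

/-- The power series `∑ₙ (-u⁻¹ h)ⁿ u⁻¹` of the inversion map of a normed algebra at a unit `u`. -/
noncomputable def ringInverseSeries (u : Rˣ) : FormalMultilinearSeries 𝕜 R R :=
  ((ContinuousLinearMap.mul 𝕜 R).flip (↑u⁻¹ : R)).compFormalMultilinearSeries
    ((formalMultilinearSeries_geometric 𝕜 R).compContinuousLinearMap
      (-ContinuousLinearMap.mul 𝕜 R (↑u⁻¹ : R)))

theorem ringInverseSeries_apply (u : Rˣ) (n : ℕ) (v : Fin n → R) :
    ringInverseSeries 𝕜 u n v = (List.ofFn fun i ↦ -(↑u⁻¹ * v i)).prod * ↑u⁻¹ := by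
  simp [ringInverseSeries, formalMultilinearSeries_geometric, Function.comp_def]

theorem Ring.inverse_eq_inverse_one_sub_mul {S : Type*} [Ring S] (u : Sˣ) (y : S) :
    Ring.inverse y = Ring.inverse (1 - -(↑u⁻¹ * (y - ↑u))) * ↑u⁻¹ := by
  have h : 1 - -(↑u⁻¹ * (y - ↑u)) = ↑u⁻¹ * y := by simp [mul_sub]
  rw [h]
  by_cases hy : IsUnit y
  · obtain ⟨w, rfl⟩ := hy
    rw [← Units.val_mul, Ring.inverse_unit, Ring.inverse_unit, ← Units.val_mul]
    simp
  · rw [Ring.inverse_non_unit _ hy, Ring.inverse_non_unit, zero_mul]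
    simpa using hy

theorem hasFPowerSeriesOnBall_ringInverse [HasSummableGeomSeries R] (u : Rˣ) :
    HasFPowerSeriesOnBall Ring.inverse (ringInverseSeries 𝕜 u) (u : R)
      (1 / ‖-ContinuousLinearMap.mul 𝕜 R (↑u⁻¹ : R)‖ₑ) := by
  have h₁ : HasFPowerSeriesOnBall (fun x : R ↦ Ring.inverse (1 - x))
      (formalMultilinearSeries_geometric 𝕜 R)
      ((-ContinuousLinearMap.mul 𝕜 R (↑u⁻¹ : R)) 0) 1 := by
    simpa using hasFPowerSeriesOnBall_inverse_one_sub 𝕜 R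
  have h₂ := (((ContinuousLinearMap.mul 𝕜 R).flip (↑u⁻¹ : R)).comp_hasFPowerSeriesOnBall
    h₁.compContinuousLinearMap).comp_sub (u : R)
  rw [zero_add] at h₂
  refine h₂.congr fun y _ ↦ ?_
  simpa using (Ring.inverse_eq_inverse_one_sub_mul u y).symm

theorem norm_ringInverseSeries_apply_le (u : Rˣ) (n : ℕ) (v : Fin n → R) :
    ‖ringInverseSeries 𝕜 u n v‖ ≤ ‖(↑u⁻¹ : R)‖ ^ (n + 1) * ∏ i, ‖v i‖ := by
  rw [ringInverseSeries_apply]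
  rcases Nat.eq_zero_or_pos n with rfl | hn
  · simp
  · have h : ‖(List.ofFn fun i ↦ -(↑u⁻¹ * v i)).prod‖ ≤ ∏ i, (‖(↑u⁻¹ : R)‖ * ‖v i‖) := by
      refine (List.norm_prod_le' (by simpa using hn.ne')).trans ?_
      rw [List.map_ofFn, List.prod_ofFn]
      refine Finset.prod_le_prod (fun _ _ ↦ norm_nonneg _) fun i _ ↦ ?_
      simpa using norm_mul_le (↑u⁻¹ : R) (v i)
    calc ‖(List.ofFn fun i ↦ -(↑u⁻¹ * v i)).prod * ↑u⁻¹‖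
        ≤ (∏ i, (‖(↑u⁻¹ : R)‖ * ‖v i‖)) * ‖(↑u⁻¹ : R)‖ :=
          (norm_mul_le _ _).trans (by gcongr)
      _ = ‖(↑u⁻¹ : R)‖ ^ (n + 1) * ∏ i, ‖v i‖ := by
          simp [Finset.prod_mul_distrib, pow_succ, mul_right_comm]

theorem norm_iteratedFDeriv_ringInverse_le [CompleteSpace R] (u : Rˣ) (n : ℕ) :
    ‖iteratedFDeriv 𝕜 n (Ring.inverse : R → R) u‖ ≤ n.factorial * ‖(↑u⁻¹ : R)‖ ^ (n + 1) := by
  refine ContinuousMultilinearMap.opNorm_le_bound (by positivity) fun v ↦ ?_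
  rw [(hasFPowerSeriesOnBall_ringInverse 𝕜 u).iteratedFDeriv_eq_sum_of_completeSpace]
  calc ‖∑ σ : Equiv.Perm (Fin n), ringInverseSeries 𝕜 u n fun i ↦ v (σ i)‖
      ≤ ∑ _σ : Equiv.Perm (Fin n), ‖(↑u⁻¹ : R)‖ ^ (n + 1) * ∏ i, ‖v i‖ := by
        refine norm_sum_le_of_le _ fun σ _ ↦ ?_
        rw [← Equiv.prod_comp σ fun i ↦ ‖v i‖]
        exact norm_ringInverseSeries_apply_le 𝕜 u n _
    _ = n.factorial * ‖(↑u⁻¹ : R)‖ ^ (n + 1) * ∏ i, ‖v i‖ := by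
        simp [Fintype.card_perm, mul_assoc]

end RingInverse

/-- For every invertible real `d×d` matrix `M` (realised as a continuous
linear endomorphism of Euclidean space, so that the operator norm is the spectral norm) and
every `r ∈ ℕ`, the `r`-th Fréchet derivative of the inversion map `M ↦ M⁻¹` satisfies
`‖D^r inv(M)‖ ≤ r! ‖M⁻¹‖₂^{r+1}`, the norm being that of an `r`-linear map. -/
theorem stmt3 (d : ℕ)
    (M : EuclideanSpace ℝ (Fin d) →L[ℝ] EuclideanSpace ℝ (Fin d)) (hM : IsUnit M)
    (r : ℕ) :
    ‖iteratedFDeriv ℝ r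
        (Ring.inverse :
          (EuclideanSpace ℝ (Fin d) →L[ℝ] EuclideanSpace ℝ (Fin d)) →
            (EuclideanSpace ℝ (Fin d) →L[ℝ] EuclideanSpace ℝ (Fin d))) M‖ ≤
      (r.factorial : ℝ) * ‖Ring.inverse M‖ ^ (r + 1) := by
  obtain ⟨u, rfl⟩ := hM
  rw [Ring.inverse_unit]
  exact norm_iteratedFDeriv_ringInverse_le ℝ u r
end

section
/- For every real d×d matrix M and every r with 0 ≤ r ≤ d, the r-th Fréchet derivative of the determinant satisfies the operator-norm bound ‖D^r det(M)‖ ≤ (d!/(d−r)!) ‖M‖₂^{d−r}, where ‖D^r det(M)‖ is the norm of D^r det(M) as an r-linear map from (ℝ^{d×d})^r to ℝ. In particular, if additionally ‖M‖₂ ≤ σ̄ with σ̄ ≥ 1, then ‖D^r det(M)‖ ≤ r! (2σ̄)^d for all r ∈ ℕ. -/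
open Module

/-- **Hadamard's inequality**: the determinant with respect to an orthonormal basis is bounded by
the product of the norms. -/
theorem OrthonormalBasis.abs_det_le_prod_norm {d : ℕ} {E : Type*} [NormedAddCommGroup E]
    [InnerProductSpace ℝ E] (b : OrthonormalBasis (Fin d) ℝ E) (v : Fin d → E) :
    |b.toBasis.det v| ≤ ∏ i, ‖v i‖ := by
  have : Fact (finrank ℝ E = d) := ⟨by simpa using finrank_eq_card_basis b.toBasis⟩
  rw [← b.toBasis.orientation.volumeForm_robust b rfl]
  exact b.toBasis.orientation.abs_volumeForm_apply_le v

/-- The multilinear map `(N₁, …, N_d) ↦ det (N₁ b₁, …, N_d b_d)` for an orthonormal basis `b`;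
on the diagonal it is the determinant. -/
noncomputable def OrthonormalBasis.columnDet {d : ℕ} {E : Type*} [NormedAddCommGroup E]
    [InnerProductSpace ℝ E] (b : OrthonormalBasis (Fin d) ℝ E) :
    ContinuousMultilinearMap ℝ (fun _ : Fin d => E →L[ℝ] E) ℝ :=
  (b.toBasis.det.toMultilinearMap.mkContinuous 1 fun v => by
      simpa using b.abs_det_le_prod_norm v).compContinuousLinearMap
    fun i => ContinuousLinearMap.apply ℝ E (b i)

theorem OrthonormalBasis.norm_columnDet_le {d : ℕ} {E : Type*} [NormedAddCommGroup E]
    [InnerProductSpace ℝ E] (b : OrthonormalBasis (Fin d) ℝ E) : ‖b.columnDet‖ ≤ 1 := by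
  refine ContinuousMultilinearMap.opNorm_le_bound zero_le_one fun N => ?_
  rw [one_mul]
  refine (b.abs_det_le_prod_norm fun i => N i (b i)).trans ?_
  gcongr with i
  simpa using (N i).le_opNorm (b i)

theorem OrthonormalBasis.columnDet_diagonal {d : ℕ} {E : Type*} [NormedAddCommGroup E]
    [InnerProductSpace ℝ E] (b : OrthonormalBasis (Fin d) ℝ E) (N : E →L[ℝ] E) :
    b.columnDet (fun _ => N) = LinearMap.det (N : E →ₗ[ℝ] E) := by
  have h := b.toBasis.det_comp (N : E →ₗ[ℝ] E) b.toBasis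
  rw [b.toBasis.det_self, mul_one] at h
  rw [← h]
  change b.toBasis.det (fun i => N (b i)) = _
  congr 1

/-- If a function is the diagonal of a continuous multilinear map, its iterated derivatives are
bounded as those of a monomial. -/
theorem ContinuousMultilinearMap.norm_iteratedFDeriv_diagonal_le {d : ℕ} {V F : Type*}
    [NormedAddCommGroup V] [NormedSpace ℝ V] [NormedAddCommGroup F] [NormedSpace ℝ F]
    (B : ContinuousMultilinearMap ℝ (fun _ : Fin d => V) F) (r : ℕ) (x : V) :
    ‖iteratedFDeriv ℝ r (fun y => B fun _ => y) x‖ ≤ d.descFactorial r * ‖B‖ * ‖x‖ ^ (d - r) := by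
  let D : V →L[ℝ] (Fin d → V) := ContinuousLinearMap.pi fun _ => ContinuousLinearMap.id ℝ V
  have hD : ‖D‖ ≤ 1 := D.opNorm_le_bound zero_le_one fun y => by
    rw [one_mul]
    exact pi_norm_const_le y
  have hcomp : (fun y => B fun _ => y) = B ∘ D := rfl
  rw [hcomp, D.iteratedFDeriv_comp_right (n := r) B.contDiff x le_rfl]
  calc
    _ ≤ ‖iteratedFDeriv ℝ r B (D x)‖ * ∏ _i : Fin r, ‖D‖ :=
      ContinuousMultilinearMap.norm_compContinuousLinearMap_le _ _
    _ ≤ ‖iteratedFDeriv ℝ r B (D x)‖ * 1 := by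
      gcongr
      exact Finset.prod_le_one (fun _ _ => norm_nonneg _) fun _ _ => hD
    _ ≤ d.descFactorial r * ‖B‖ * ‖D x‖ ^ (d - r) := by
      simpa using B.norm_iteratedFDeriv_le r (D x)
    _ ≤ _ := by
      gcongr
      exact pi_norm_const_le x

theorem norm_iteratedFDeriv_det_le {d : ℕ} {E : Type*} [NormedAddCommGroup E]
    [InnerProductSpace ℝ E] (b : OrthonormalBasis (Fin d) ℝ E) (r : ℕ) (M : E →L[ℝ] E) :
    ‖iteratedFDeriv ℝ r (fun N : E →L[ℝ] E => LinearMap.det (N : E →ₗ[ℝ] E)) M‖ ≤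
      d.descFactorial r * ‖M‖ ^ (d - r) := by
  simp_rw [← b.columnDet_diagonal]
  refine (b.columnDet.norm_iteratedFDeriv_diagonal_le r M).trans ?_
  gcongr
  exact mul_le_of_le_one_right (Nat.cast_nonneg _) b.norm_columnDet_le


/-- For every real `d×d` matrix `M` (realised as a continuous linear
endomorphism of Euclidean space, whose operator norm is the spectral norm `‖·‖₂`) and every
`0 ≤ r ≤ d`, the `r`-th Fréchet derivative of the determinant satisfies
`‖D^r det(M)‖ ≤ (d!/(d−r)!) ‖M‖₂^{d−r}`; and if moreover `‖M‖₂ ≤ σ̄` with `σ̄ ≥ 1`, then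
`‖D^r det(M)‖ ≤ r! (2σ̄)^d` for all `r ∈ ℕ`. -/
theorem stmt5 (d : ℕ) (M : EuclideanSpace ℝ (Fin d) →L[ℝ] EuclideanSpace ℝ (Fin d)) :
    (∀ r : ℕ, r ≤ d →
      ‖iteratedFDeriv ℝ r
          (fun N : EuclideanSpace ℝ (Fin d) →L[ℝ] EuclideanSpace ℝ (Fin d) =>
            LinearMap.det (N : EuclideanSpace ℝ (Fin d) →ₗ[ℝ] EuclideanSpace ℝ (Fin d))) M‖ ≤
        ((d.factorial : ℝ) / ((d - r).factorial : ℝ)) * ‖M‖ ^ (d - r)) ∧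
    ∀ σu : ℝ, 1 ≤ σu → ‖M‖ ≤ σu → ∀ r : ℕ,
      ‖iteratedFDeriv ℝ r
          (fun N : EuclideanSpace ℝ (Fin d) →L[ℝ] EuclideanSpace ℝ (Fin d) =>
            LinearMap.det (N : EuclideanSpace ℝ (Fin d) →ₗ[ℝ] EuclideanSpace ℝ (Fin d))) M‖ ≤
        (r.factorial : ℝ) * (2 * σu) ^ d := by
  have key := fun r =>
    norm_iteratedFDeriv_det_le (EuclideanSpace.basisFun (Fin d) ℝ) r M
  refine ⟨fun r hr => (key r).trans_eq ?_, fun σu hσ hM r => (key r).trans ?_⟩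
  · rw [← Nat.factorial_mul_descFactorial hr, Nat.cast_mul,
      mul_div_cancel_left₀ _ (Nat.cast_ne_zero.2 (d - r).factorial_ne_zero)]
  · rw [Nat.descFactorial_eq_factorial_mul_choose, Nat.cast_mul, mul_assoc, mul_pow]
    gcongr
    · exact_mod_cast Nat.choose_le_two_pow d r
    · exact (pow_le_pow_left₀ (norm_nonneg M) hM _).trans
        (pow_le_pow_right₀ hσ (Nat.sub_le d r))
end

section
/- Let 0 < σ̲ ≤ 1 ≤ σ̄ < ∞, let 𝒟 ⊂ ℝ^d be a bounded set, and let ℝ^{d×d}_{σ̲,σ̄} denote the set of real d×d matrices all of whose singular values lie in [σ̲, σ̄]. Then the map T₄ : (v, M) ↦ (MᵀM)⁻¹ is infinitely Fréchet differentiable on a neighbourhood of 𝒟 × ℝ^{d×d}_{σ̲,σ̄} and satisfies, for every r ∈ ℕ and every (v, M) ∈ 𝒟 × ℝ^{d×d}_{σ̲,σ̄}, the bound ‖D^r T₄(v, M)‖ ≤ r! k₄ c₄^r with k₄ = σ̲^{−2} and c₄ = 2(σ̲^{−2}σ̄² + 1), where ‖D^r T₄(v, M)‖ is the norm of D^r T₄(v,M)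 as an r-linear map from (ℝ^d × ℝ^{d×d})^r to ℝ^{d×d}. -/
open ContinuousLinearMap

theorem ContinuousLinearMap.iteratedFDeriv_eq_zero {𝕜 E F : Type*} [NontriviallyNormedField 𝕜]
    [NormedAddCommGroup E] [NormedSpace 𝕜 E] [NormedAddCommGroup F] [NormedSpace 𝕜 F]
    (L : E →L[𝕜] F) (x : E) {n : ℕ} (hn : 2 ≤ n) : iteratedFDeriv 𝕜 n L x = 0 := by
  obtain ⟨k, rfl⟩ : ∃ k, n = k + 1 + 1 := ⟨n - 2, by omega⟩
  have h : fderiv 𝕜 L = fun _ => L := funext fun y => L.fderiv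
  rw [← norm_eq_zero, ← norm_iteratedFDeriv_fderiv, h, iteratedFDeriv_succ_const]
  simp

section MulLinear

variable {𝕜 X R : Type*} [NontriviallyNormedField 𝕜] [NormedAddCommGroup X] [NormedSpace 𝕜 X]
  [NormedRing R] [NormedAlgebra 𝕜 R] (L₁ L₂ : X →L[𝕜] R) (x : X)

theorem norm_iteratedFDeriv_one_clm_mul_clm_le :
    ‖iteratedFDeriv 𝕜 1 (fun y => L₁ y * L₂ y) x‖ ≤ ‖L₁ x‖ * ‖L₂‖ + ‖L₁‖ * ‖L₂ x‖ := by
  refine (norm_iteratedFDeriv_mul_le L₁.contDiff L₂.contDiff x (N := 1) le_rfl).trans_eq ?_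
  simp [Finset.sum_range_succ]

theorem norm_iteratedFDeriv_two_clm_mul_clm_le :
    ‖iteratedFDeriv 𝕜 2 (fun y => L₁ y * L₂ y) x‖ ≤ 2 * (‖L₁‖ * ‖L₂‖) := by
  refine (norm_iteratedFDeriv_mul_le L₁.contDiff L₂.contDiff x (N := 2) le_rfl).trans_eq ?_
  simp [Finset.sum_range_succ, iteratedFDeriv_eq_zero _ x le_rfl, mul_assoc]

theorem iteratedFDeriv_clm_mul_clm_eq_zero {n : ℕ} (hn : 3 ≤ n) :
    iteratedFDeriv 𝕜 n (fun y => L₁ y * L₂ y) x = 0 := by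
  refine norm_le_zero_iff.1 ((norm_iteratedFDeriv_mul_le L₁.contDiff L₂.contDiff x
    (N := n) le_rfl).trans_eq (Finset.sum_eq_zero fun i _ => ?_))
  rcases le_or_gt 2 i with hi | hi
  · simp [iteratedFDeriv_eq_zero L₁ x hi]
  · simp [iteratedFDeriv_eq_zero L₂ x (show 2 ≤ n - i by omega)]

end MulLinear

section StarMul

variable {V R : Type*} [NormedAddCommGroup V] [NormedSpace ℝ V]
  [NormedRing R] [NormedAlgebra ℝ R] [StarRing R] [NormedStarGroup R] [StarModule ℝ R]

theorem norm_starL'_comp_snd_le_one :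
    ‖((starL' ℝ : R ≃L[ℝ] R) : R →L[ℝ] R).comp (snd ℝ V R)‖ ≤ 1 :=
  opNorm_le_bound _ zero_le_one fun p => by
    simpa using _root_.norm_snd_le p

theorem contDiff_star_mul_self_snd {n : WithTop ℕ∞} :
    ContDiff ℝ n fun p : V × R => star p.2 * p.2 :=
  (((starL' ℝ : R ≃L[ℝ] R) : R →L[ℝ] R).comp (snd ℝ V R)).contDiff.mul contDiff_snd

theorem norm_iteratedFDeriv_one_star_mul_self_le (p : V × R) :
    ‖iteratedFDeriv ℝ 1 (fun p : V × R => star p.2 * p.2) p‖ ≤ 2 * ‖p.2‖ := by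
  have h := norm_iteratedFDeriv_one_clm_mul_clm_le
    (((starL' ℝ : R ≃L[ℝ] R) : R →L[ℝ] R).comp (snd ℝ V R)) (snd ℝ V R) p
  have h₁ := mul_le_of_le_one_right (norm_nonneg p.2) (ContinuousLinearMap.norm_snd_le ℝ V R)
  have h₂ := mul_le_of_le_one_left (norm_nonneg p.2) (norm_starL'_comp_snd_le_one (V := V) (R := R))
  have h₃ : ‖(((starL' ℝ : R ≃L[ℝ] R) : R →L[ℝ] R).comp (snd ℝ V R)) p‖ = ‖p.2‖ := by simp
  rw [h₃] at h
  exact h.trans ((add_le_add h₁ h₂).trans_eq (two_mul _).symm)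

theorem norm_iteratedFDeriv_two_star_mul_self_le (p : V × R) :
    ‖iteratedFDeriv ℝ 2 (fun p : V × R => star p.2 * p.2) p‖ ≤ 2 := by
  have h := mul_le_one₀ (norm_starL'_comp_snd_le_one (V := V) (R := R)) (norm_nonneg (snd ℝ V R))
    (ContinuousLinearMap.norm_snd_le ℝ V R)
  exact (norm_iteratedFDeriv_two_clm_mul_clm_le
    (((starL' ℝ : R ≃L[ℝ] R) : R →L[ℝ] R).comp (snd ℝ V R)) (snd ℝ V R) p).trans (by linarith)

theorem iteratedFDeriv_star_mul_self_eq_zero (p : V × R) {n : ℕ} (hn : 3 ≤ n) :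
    iteratedFDeriv ℝ n (fun p : V × R => star p.2 * p.2) p = 0 :=
  iteratedFDeriv_clm_mul_clm_eq_zero
    (((starL' ℝ : R ≃L[ℝ] R) : R →L[ℝ] R).comp (snd ℝ V R)) (snd ℝ V R) p hn

/-- The Leibniz recursion for the derivatives of `(star M * M)⁻¹`: differentiate
`(star M * M)⁻¹ = A⁻¹ - A⁻¹ * (star M * M - A) * (star M * M)⁻¹`, where `A` is the value of
`star M * M` at the base point. -/
theorem norm_iteratedFDeriv_inverse_star_mul_self_le [HasSummableGeomSeries R] (p : V × R)
    (hp : IsUnit (star p.2 * p.2)) {n : ℕ} (hn : n ≠ 0) :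
    ‖iteratedFDeriv ℝ n (fun p : V × R => Ring.inverse (star p.2 * p.2)) p‖ ≤
      ‖Ring.inverse (star p.2 * p.2)‖ *
        ∑ i ∈ Finset.range n, (n.choose (i + 1) : ℝ) *
          ‖iteratedFDeriv ℝ (i + 1) (fun p : V × R => star p.2 * p.2) p‖ *
          ‖iteratedFDeriv ℝ (n - (i + 1))
            (fun p : V × R => Ring.inverse (star p.2 * p.2)) p‖ := by
  set G : V × R → R := fun p => star p.2 * p.2 with hG
  set F : V × R → R := fun p => Ring.inverse (G p) with hF
  set A := G p with hA
  set B := Ring.inverse A with hB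
  set q : V × R → R := fun x => G x - A with hq
  have hGc : ContDiff ℝ n G := contDiff_star_mul_self_snd
  have hqc : ContDiff ℝ n q := hGc.sub contDiff_const
  set U : Set (V × R) := G ⁻¹' {x | IsUnit x} with hU
  have hUo : IsOpen U := Units.isOpen.preimage hGc.continuous
  have hFc : ContDiffOn ℝ n F U := fun x hx => by
    obtain ⟨u, hu⟩ : IsUnit (G x) := hx
    have := contDiffAt_ringInverse ℝ (n := n) u
    rw [hu] at this
    exact (this.comp x hGc.contDiffAt).contDiffWithinAt
  have hqF : ContDiffOn ℝ n (fun x => q x * F x) U := hqc.contDiffOn.mul hFc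
  have hpU : p ∈ U := hp
  have hUn : U ∈ nhds p := hUo.mem_nhds hpU
  have hid : F =ᶠ[nhds p] fun x => B - (ContinuousLinearMap.mul ℝ R B ∘ fun y => q y * F y) x := by
    filter_upwards [hUn] with x hx
    have h₁ : G x * F x = 1 := Ring.mul_inverse_cancel _ hx
    have h₂ : B * A = 1 := Ring.inverse_mul_cancel _ hp
    simp only [Function.comp, ContinuousLinearMap.mul_apply', hq, sub_mul, mul_sub, h₁, mul_one]
    rw [← mul_assoc, h₂, one_mul, sub_sub_cancel]
  have hqFp := hqF.contDiffAt hUn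
  obtain ⟨m, rfl⟩ : ∃ m, n = m + 1 := Nat.exists_eq_succ_of_ne_zero hn
  have hqi : ∀ i, iteratedFDeriv ℝ (i + 1) q p = iteratedFDeriv ℝ (i + 1) G p := fun i => by
    have h := fun_iteratedFDeriv_sub_apply (𝕜 := ℝ) (i := i + 1) (x := p) (f := G) (g := fun _ => A)
      (contDiff_star_mul_self_snd.contDiffAt) contDiffAt_const
    rw [iteratedFDeriv_succ_const] at h
    simpa using h
  have hle := norm_iteratedFDerivWithin_mul_le (𝕜 := ℝ) (n := m + 1) hqc.contDiffOn hFc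
    hUo.uniqueDiffOn hpU le_rfl
  simp only [iteratedFDerivWithin_of_isOpen _ hUo hpU] at hle
  rw [Finset.sum_range_succ'] at hle
  simp only [hqi, norm_iteratedFDeriv_zero, show q p = 0 from sub_self _, norm_zero, mul_zero,
    zero_mul, add_zero] at hle
  rw [(hid.iteratedFDeriv ℝ (m + 1)).eq_of_nhds,
    fun_iteratedFDeriv_sub_apply contDiffAt_const
      ((ContinuousLinearMap.contDiff _).contDiffAt.comp p hqFp),
    iteratedFDeriv_succ_const, Pi.zero_apply, zero_sub, norm_neg]
  refine (norm_iteratedFDeriv_comp_left _ hqFp le_rfl).trans ?_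
  exact mul_le_mul (opNorm_mul_apply_le ℝ R B) hle (norm_nonneg _) (norm_nonneg _)

theorem norm_iteratedFDeriv_inverse_star_mul_self_le_factorial [HasSummableGeomSeries R]
    (p : V × R) (hp : IsUnit (star p.2 * p.2)) {a s c : ℝ} (ha : ‖Ring.inverse (star p.2 * p.2)‖ ≤ a)
    (hs : ‖p.2‖ ≤ s) (hc₁ : 2 * a * s ≤ c) (hc₂ : a * (2 * s * c + 1) ≤ c ^ 2) (n : ℕ) :
    ‖iteratedFDeriv ℝ n (fun p : V × R => Ring.inverse (star p.2 * p.2)) p‖ ≤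
      n.factorial * a * c ^ n := by
  have ha0 : 0 ≤ a := (norm_nonneg _).trans ha
  have hs0 : 0 ≤ s := (norm_nonneg _).trans hs
  have hc0 : 0 ≤ c := le_trans (by positivity) hc₁
  have h1 := (norm_iteratedFDeriv_one_star_mul_self_le p).trans (by gcongr : _ ≤ 2 * s)
  have h2 := norm_iteratedFDeriv_two_star_mul_self_le p
  induction n using Nat.strong_induction_on with
  | _ n ih =>
  match n, ih with
  | 0, _ => simpa using ha
  | 1, ih =>
    have h0 := ih 0 one_pos
    have h := norm_iteratedFDeriv_inverse_star_mul_self_le p hp one_ne_zero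
    simp only [Finset.sum_range_one, zero_add, Nat.choose_self, Nat.cast_one, one_mul] at h
    simp only [Nat.factorial, Nat.cast_one, one_mul, pow_zero, mul_one] at h0
    calc _ ≤ a * (2 * s * a) := h.trans (by gcongr; exact h0)
      _ = a * (2 * a * s) := by ring
      _ ≤ a * c := by gcongr
      _ = _ := by simp
  | k + 2, ih =>
    have h := norm_iteratedFDeriv_inverse_star_mul_self_le p hp (n := k + 2) (by omega)
    rw [Finset.sum_range_succ', Finset.sum_range_succ', Finset.sum_eq_zero fun i _ => by
      rw [iteratedFDeriv_star_mul_self_eq_zero p (by omega)]; simp] at h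
    have e1 : k + 2 - (0 + 1) = k + 1 := by omega
    have e2 : k + 2 - (0 + 1 + 1) = k := by omega
    have c2 : ((k + 2).choose 2 : ℝ) * 2 = (k + 2) * (k + 1) := by
      rw [Nat.cast_choose_two]; push_cast; ring
    rw [e1, e2] at h
    simp only [zero_add, Nat.reduceAdd, Nat.choose_one_right] at h
    have i1 := ih (k + 1) (by omega)
    have i0 := ih k (by omega)
    calc _ ≤ a * (((k + 2).choose 2 : ℝ) * 2 * (k.factorial * a * c ^ k) +
          ((k + 2 : ℕ) : ℝ) * (2 * s) * ((k + 1).factorial * a * c ^ (k + 1))) :=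
            h.trans (by gcongr)
      _ = (k + 2).factorial * a * c ^ k * (a * (2 * s * c + 1)) := by
        rw [c2]; push_cast [Nat.factorial_succ]; ring
      _ ≤ (k + 2).factorial * a * c ^ k * c ^ 2 := by gcongr
      _ = _ := by ring

end StarMul

section BoundedBelow

variable {E : Type*} [NormedAddCommGroup E] [InnerProductSpace ℝ E] [FiniteDimensional ℝ E]
  {M : E →L[ℝ] E} {σ : ℝ}

theorem sq_mul_norm_le_norm_adjoint_mul_self_apply (hσ : 0 ≤ σ) (h : ∀ x, σ * ‖x‖ ≤ ‖M x‖)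
    (x : E) : σ ^ 2 * ‖x‖ ≤ ‖(adjoint M * M) x‖ := by
  rcases (norm_nonneg x).eq_or_lt with hx | hx
  · simp [← hx]
  refine le_of_mul_le_mul_right ?_ hx
  calc σ ^ 2 * ‖x‖ * ‖x‖ = (σ * ‖x‖) ^ 2 := by ring
    _ ≤ ‖M x‖ ^ 2 := by gcongr; exact h x
    _ = inner ℝ ((adjoint M * M) x) x := by
      rw [mul_apply_eq_comp, adjoint_inner_left, real_inner_self_eq_norm_sq]
    _ ≤ _ := real_inner_le_norm _ _

theorem isUnit_adjoint_mul_self (hσ : 0 < σ) (h : ∀ x, σ * ‖x‖ ≤ ‖M x‖) :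
    IsUnit (adjoint M * M) := by
  have hinj : Function.Injective (adjoint M * M) := by
    refine (injective_iff_map_eq_zero _).2 fun x hx => norm_le_zero_iff.1 ?_
    have h' := sq_mul_norm_le_norm_adjoint_mul_self_apply hσ.le h x
    rw [hx, norm_zero] at h'
    exact nonpos_of_mul_nonpos_right h' (by positivity)
  exact isUnit_iff_bijective.2
    ⟨hinj, (LinearMap.injective_iff_surjective (f := (adjoint M * M).toLinearMap)).1 hinj⟩

theorem norm_inverse_adjoint_mul_self_le (hσ : 0 < σ) (h : ∀ x, σ * ‖x‖ ≤ ‖M x‖) :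
    ‖Ring.inverse (adjoint M * M)‖ ≤ (σ ^ 2)⁻¹ := by
  refine opNorm_le_bound _ (by positivity) fun x => ?_
  have h' := sq_mul_norm_le_norm_adjoint_mul_self_apply hσ.le h (Ring.inverse (adjoint M * M) x)
  rw [← mul_apply_eq_comp, Ring.mul_inverse_cancel _ (isUnit_adjoint_mul_self hσ h),
    one_apply_eq_self] at h'
  rwa [inv_mul_eq_div, le_div_iff₀' (by positivity)]

end BoundedBelow


/-- Let `0 < σ̲ ≤ 1 ≤ σ̄`, `𝒟 ⊆ ℝ^d` bounded, and let `S` be the set of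
real `d×d` matrices (continuous linear endomorphisms of Euclidean space, so the operator
norm is the spectral norm) all of whose singular values lie in `[σ̲, σ̄]`.  Then
`T₄ : (v, M) ↦ (MᵀM)⁻¹` is infinitely Fréchet differentiable on a neighbourhood of
`𝒟 × S` and satisfies `‖D^r T₄(v,M)‖ ≤ r! k₄ c₄^r` on `𝒟 × S`, with `k₄ = σ̲⁻²` and
`c₄ = 2(σ̲⁻²σ̄² + 1)`. -/
theorem stmt7 (d : ℕ) (σl σu : ℝ) (hσl : 0 < σl) (hσl1 : σl ≤ 1) (hσu : 1 ≤ σu)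
    (𝒟 : Set (EuclideanSpace ℝ (Fin d))) (h𝒟 : Bornology.IsBounded 𝒟) :
    (∃ U : Set (EuclideanSpace ℝ (Fin d) ×
        (EuclideanSpace ℝ (Fin d) →L[ℝ] EuclideanSpace ℝ (Fin d))),
      IsOpen U ∧
      (𝒟 ×ˢ {M : EuclideanSpace ℝ (Fin d) →L[ℝ] EuclideanSpace ℝ (Fin d) |
        ∀ x, σl * ‖x‖ ≤ ‖M x‖ ∧ ‖M x‖ ≤ σu * ‖x‖}) ⊆ U ∧
      ContDiffOn ℝ (⊤ : ℕ∞)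
        (fun p : EuclideanSpace ℝ (Fin d) ×
            (EuclideanSpace ℝ (Fin d) →L[ℝ] EuclideanSpace ℝ (Fin d)) =>
          Ring.inverse (adjoint p.2 * p.2)) U) ∧
    ∀ r : ℕ, ∀ v ∈ 𝒟,
      ∀ M : EuclideanSpace ℝ (Fin d) →L[ℝ] EuclideanSpace ℝ (Fin d),
        (∀ x, σl * ‖x‖ ≤ ‖M x‖ ∧ ‖M x‖ ≤ σu * ‖x‖) →
        ‖iteratedFDeriv ℝ r
            (fun p : EuclideanSpace ℝ (Fin d) ×
                (EuclideanSpace ℝ (Fin d) →L[ℝ] EuclideanSpace ℝ (Fin d)) =>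
              Ring.inverse (adjoint p.2 * p.2)) (v, M)‖ ≤
          (r.factorial : ℝ) * (σl ^ 2)⁻¹ * (2 * ((σl ^ 2)⁻¹ * σu ^ 2 + 1)) ^ r := by
  refine ⟨⟨_, Units.isOpen.preimage (contDiff_star_mul_self_snd
    (V := EuclideanSpace ℝ (Fin d)) (R := EuclideanSpace ℝ (Fin d) →L[ℝ] EuclideanSpace ℝ (Fin d))
    (n := 0)).continuous, ?_, ?_⟩, ?_⟩
  · rintro ⟨v, M⟩ ⟨-, hM⟩
    exact isUnit_adjoint_mul_self hσl fun x => (hM x).1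
  · rintro p ⟨u, hu⟩
    have h := contDiffAt_ringInverse ℝ (n := (⊤ : ℕ∞)) u
    rw [hu] at h
    exact (h.comp p contDiff_star_mul_self_snd.contDiffAt).contDiffWithinAt
  · intro r v _ M hM
    have ha : 0 < (σl ^ 2)⁻¹ := by positivity
    have hss : σu ≤ σu ^ 2 := le_self_pow₀ hσu two_ne_zero
    have has : (σl ^ 2)⁻¹ * σu ≤ (σl ^ 2)⁻¹ * σu ^ 2 := by gcongr
    have has' : (σl ^ 2)⁻¹ ≤ (σl ^ 2)⁻¹ * σu ^ 2 := le_mul_of_one_le_right ha.le (hσu.trans hss)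
    refine norm_iteratedFDeriv_inverse_star_mul_self_le_factorial (v, M)
      (isUnit_adjoint_mul_self hσl fun x => (hM x).1)
      (norm_inverse_adjoint_mul_self_le hσl fun x => (hM x).1)
      (opNorm_le_bound _ (zero_le_one.trans hσu) fun x => (hM x).2) (by linarith) ?_ r
    generalize (σl ^ 2)⁻¹ = a at *
    nlinarith [mul_le_mul_of_nonneg_right has (show 0 ≤ a * σu ^ 2 + 1 by positivity)]
end

section
/- Let γ = (γ_n)_{n≥1} be a sequence of nonnegative reals, let k ≥ 2 and c > 0 be reals, and let a be a function from the set of finitely supported multi-indices to the nonnegative reals such that a(0) ≤ k and, for every multi-index α ≠ 0, a(α) ≤ (k/3)|α|! c^{|α|} γ^α + (k/3) Σ_{β < α} binom(α, β) |α − β|! c^{|α−β|} γ^{α−β} a(β). Then for every multi-index α one has a(α) ≤ |α|! γ^α k (kc)^{|α|}. -/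
theorem Finsupp.sum_Iic_prod {ι R : Type*} [DecidableEq ι] [CommSemiring R] (α : ι →₀ ℕ)
    (f : ι → ℕ → R) :
    ∑ β ∈ Finset.Iic α, ∏ n ∈ α.support, f n (β n) =
      ∏ n ∈ α.support, ∑ i ∈ Finset.range (α n + 1), f n i := by
  rw [Finset.prod_sum]
  refine Finset.sum_bij' (fun β _ n _ => β n) (fun p _ => Finsupp.indicator α.support p)
    ?_ ?_ ?_ ?_ ?_
  · intro β hβ
    simp only [Finset.mem_pi, Finset.mem_range, Nat.lt_succ_iff]
    exact fun n _ => Finset.mem_Iic.1 hβ n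
  · intro p hp
    simp only [Finset.mem_pi, Finset.mem_range, Nat.lt_succ_iff] at hp
    refine Finset.mem_Iic.2 fun n => ?_
    by_cases hn : n ∈ α.support
    · rw [Finsupp.indicator_of_mem hn]
      exact hp n hn
    · rw [Finsupp.indicator_of_notMem hn]
      exact Nat.zero_le _
  · intro β hβ
    ext n
    by_cases hn : n ∈ α.support
    · rw [Finsupp.indicator_of_mem hn]
    · rw [Finsupp.indicator_of_notMem hn]
      have := Finset.mem_Iic.1 hβ n
      rw [Finsupp.notMem_support_iff.1 hn] at this
      omega
  · intro p hp
    funext n hn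
    exact Finsupp.indicator_of_mem hn p
  · intro β hβ
    exact (Finset.prod_attach _ fun n => f n (β n)).symm

theorem Finsupp.degree_eq_sum_of_le {ι : Type*} {α β : ι →₀ ℕ} (h : β ≤ α) :
    β.degree = ∑ n ∈ α.support, β n :=
  Finset.sum_subset (Finsupp.support_mono h) fun _ _ hn => Finsupp.notMem_support_iff.1 hn

open Polynomial in
/-- Vandermonde's identity for multi-indices. -/
theorem Finsupp.sum_prod_choose_of_degree_eq {ι : Type*} [DecidableEq ι] (α : ι →₀ ℕ) (j : ℕ) :
    ∑ β ∈ Finset.Iic α with β.degree = j, ∏ n ∈ α.support, (α n).choose (β n) =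
      α.degree.choose j := by
  have h := Finsupp.sum_Iic_prod α fun n i => X ^ i * ((α n).choose i : ℕ[X])
  have hbinom (n : ι) :
      ∑ i ∈ Finset.range (α n + 1), X ^ i * ((α n).choose i : ℕ[X]) = (X + 1) ^ α n := by
    simp [add_pow]
  simp only [hbinom] at h
  rw [Finset.prod_pow_eq_pow_sum, ← Finsupp.degree_apply] at h
  rw [← Nat.cast_id (α.degree.choose j), ← coeff_X_add_one_pow ℕ α.degree j, ← h,
    finsetSum_coeff, Finset.sum_filter]
  refine Finset.sum_congr rfl fun β hβ => ?_
  rw [Finset.prod_mul_distrib, Finset.prod_pow_eq_pow_sum,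
    ← Finsupp.degree_eq_sum_of_le (Finset.mem_Iic.1 hβ), ← Nat.cast_prod, coeff_mul_natCast,
    coeff_X_pow]
  simp [eq_comm]

theorem Finsupp.sum_Iic_prod_choose_mul {ι R : Type*} [DecidableEq ι] [CommSemiring R]
    (α : ι →₀ ℕ) (F : ℕ → R) :
    ∑ β ∈ Finset.Iic α, (∏ n ∈ α.support, ((α n).choose (β n) : R)) * F β.degree =
      ∑ j ∈ Finset.range (α.degree + 1), (α.degree.choose j : R) * F j := by
  have hmaps : ∀ β ∈ Finset.Iic α, β.degree ∈ Finset.range (α.degree + 1) := fun β hβ =>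
    Finset.mem_range_succ_iff.2 (Finsupp.degree_mono (Finset.mem_Iic.1 hβ))
  rw [← Finset.sum_fiberwise_of_maps_to hmaps]
  refine Finset.sum_congr rfl fun j _ => ?_
  rw [← Finsupp.sum_prod_choose_of_degree_eq α j, Nat.cast_sum, Finset.sum_mul]
  refine Finset.sum_congr rfl fun β hβ => ?_
  rw [(Finset.mem_filter.1 hβ).2, Nat.cast_prod]

theorem Finsupp.sum_Iio_prod_choose_mul {ι R : Type*} [DecidableEq ι] [CommRing R]
    (α : ι →₀ ℕ) (F : ℕ → R) :
    ∑ β ∈ Finset.Iio α, (∏ n ∈ α.support, ((α n).choose (β n) : R)) * F β.degree =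
      ∑ j ∈ Finset.range α.degree, (α.degree.choose j : R) * F j := by
  have h := Finsupp.sum_Iic_prod_choose_mul α F
  rw [← Finset.Iio_insert, Finset.sum_insert (by simp), Finset.sum_range_succ, add_comm] at h
  simpa using h

theorem one_add_mul_geom_sum_le {k : ℝ} (hk : 2 ≤ k) (m : ℕ) :
    1 + k * ∑ j ∈ Finset.range m, k ^ j ≤ 3 * k ^ m := by
  have hS : 0 ≤ ∑ j ∈ Finset.range m, k ^ j :=
    Finset.sum_nonneg fun j _ => pow_nonneg (by linarith) j
  have hpow : 0 ≤ k ^ m := pow_nonneg (by linarith) m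
  nlinarith [geom_sum_mul k m, mul_nonneg (sub_nonneg.2 hk) hS]


/-- Let `γ = (γ_n)_{n≥1}` be nonnegative reals, `k ≥ 2`, `c > 0`, and let
`a` be a nonnegative function on finitely supported multi-indices with `a(0) ≤ k` and, for
`α ≠ 0`,
`a(α) ≤ (k/3)|α|! c^{|α|} γ^α + (k/3) Σ_{β<α} binom(α,β)|α−β|! c^{|α−β|} γ^{α−β} a(β)`.
Then `a(α) ≤ |α|! γ^α k (kc)^{|α|}` for every multi-index `α`. -/
theorem stmt14 (γ : ℕ+ → ℝ) (hγ : ∀ n, 0 ≤ γ n) (k c : ℝ) (hk : 2 ≤ k) (hc : 0 < c)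
    (a : (ℕ+ →₀ ℕ) → ℝ) (ha0 : ∀ α, 0 ≤ a α) (hbase : a 0 ≤ k)
    (hrec : ∀ α : ℕ+ →₀ ℕ, α ≠ 0 →
      a α ≤ k / 3 * ((∑ n ∈ α.support, α n).factorial : ℝ) *
              c ^ (∑ n ∈ α.support, α n) * (∏ n ∈ α.support, γ n ^ α n)
          + k / 3 * ∑ β ∈ Finset.Iio α,
              (∏ n ∈ α.support, ((α n).choose (β n) : ℝ)) *
                (((∑ n ∈ (α - β).support, (α - β) n).factorial : ℝ) *
                  (c ^ (∑ n ∈ (α - β).support, (α - β) n) *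
                    ((∏ n ∈ (α - β).support, γ n ^ (α - β) n) * a β)))) :
    ∀ α : ℕ+ →₀ ℕ,
      a α ≤ ((∑ n ∈ α.support, α n).factorial : ℝ) * (∏ n ∈ α.support, γ n ^ α n) *
              k * (k * c) ^ (∑ n ∈ α.support, α n) := by
  simp only [← Finsupp.degree_apply] at hrec ⊢
  set g : (ℕ+ →₀ ℕ) → ℝ := fun α => ∏ n ∈ α.support, γ n ^ α n with hg
  have hg_nonneg (α) : 0 ≤ g α := Finset.prod_nonneg fun n _ => pow_nonneg (hγ n) _
  have hg_add (α β) : g (α + β) = g α * g β :=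
    Finsupp.prod_add_index' (h := fun n i => γ n ^ i) (fun _ => pow_zero _)
      fun _ _ _ => pow_add _ _ _
  change ∀ α, a α ≤ (α.degree.factorial : ℝ) * g α * k * (k * c) ^ α.degree
  intro α
  induction α using WellFoundedLT.induction with | _ α ih
  rcases eq_or_ne α 0 with rfl | hα
  · simpa [hg] using hbase
  have hterm : ∀ β ∈ Finset.Iio α,
      (∏ n ∈ α.support, ((α n).choose (β n) : ℝ)) *
        (((α - β).degree.factorial : ℝ) * (c ^ (α - β).degree * (g (α - β) * a β))) ≤
      (∏ n ∈ α.support, ((α n).choose (β n) : ℝ)) *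
        (((α.degree - β.degree).factorial * β.degree.factorial : ℝ) * k ^ β.degree *
          (k * c ^ α.degree * g α)) := by
    intro β hβ
    have hlt := Finset.mem_Iio.1 hβ
    have hsplit : α - β + β = α := tsub_add_cancel_of_le hlt.le
    have hdeg : (α - β).degree + β.degree = α.degree := by rw [← map_add, hsplit]
    have hsub : α.degree - β.degree = (α - β).degree := by omega
    have hgα : g α = g (α - β) * g β := by rw [← hg_add, hsplit]
    refine mul_le_mul_of_nonneg_left ?_ (Finset.prod_nonneg fun n _ => Nat.cast_nonneg _)
    calc _ ≤ ((α - β).degree.factorial : ℝ) * (c ^ (α - β).degree * (g (α - β) *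
            ((β.degree.factorial : ℝ) * g β * k * (k * c) ^ β.degree))) := by
          have := hg_nonneg (α - β)
          gcongr
          exact ih β hlt
      _ = _ := by
          rw [hsub, hgα, ← hdeg]
          ring
  have hsum := Finset.sum_le_sum hterm
  rw [Finsupp.sum_Iio_prod_choose_mul α fun j =>
    ((α.degree - j).factorial * j.factorial : ℝ) * k ^ j * (k * c ^ α.degree * g α)] at hsum
  have hfact : ∑ j ∈ Finset.range α.degree, (α.degree.choose j : ℝ) *
      (((α.degree - j).factorial * j.factorial : ℝ) * k ^ j * (k * c ^ α.degree * g α)) =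
      (α.degree.factorial : ℝ) * c ^ α.degree * g α *
        (k * ∑ j ∈ Finset.range α.degree, k ^ j) := by
    rw [Finset.mul_sum, Finset.mul_sum]
    refine Finset.sum_congr rfl fun j hj => ?_
    rw [← Nat.choose_mul_factorial_mul_factorial (Finset.mem_range.1 hj).le]
    push_cast
    ring
  rw [hfact] at hsum
  have hk0 : 0 ≤ k / 3 := by linarith
  have hcoef : 0 ≤ k / 3 * ((α.degree.factorial : ℝ) * c ^ α.degree * g α) := by
    have := hg_nonneg α
    positivity
  calc a α ≤ _ := hrec α hα
    _ ≤ k / 3 * (α.degree.factorial : ℝ) * c ^ α.degree * g α +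
          k / 3 * ((α.degree.factorial : ℝ) * c ^ α.degree * g α *
            (k * ∑ j ∈ Finset.range α.degree, k ^ j)) :=
        add_le_add_right (mul_le_mul_of_nonneg_left hsum hk0) _
    _ = k / 3 * ((α.degree.factorial : ℝ) * c ^ α.degree * g α) *
          (1 + k * ∑ j ∈ Finset.range α.degree, k ^ j) := by ring
    _ ≤ k / 3 * ((α.degree.factorial : ℝ) * c ^ α.degree * g α) * (3 * k ^ α.degree) :=
        mul_le_mul_of_nonneg_left (one_add_mul_geom_sum_le hk _) hcoef
    _ = _ := by ring
end
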